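/- arXiv:1903.02397 — 3 statements merged into one kernel-verified Lean document; each statement's English description precedes it below -/
import Mathlib

section
/- For an uncountable Polish space X, the Continuum Hypothesis holds if and only if there exists a lifting Φ : 𝓑 → 𝓑 on the σ-algebra 𝓑 of Borel subsets of X with respect to the σ-ideal of countable subsets of X. -/
open Set Cardinal

/-- `Φ` is a lifting on the Borel σ-algebra of `X` with respect to the σ-ideal of
countable sets: it maps Borel sets to Borel sets and satisfies conditions (1)–(5). -/
def IsCountableLifting {X : Type*} [MeasurableSpace X] (Φ : Set X → Set X) : Prop :=
  (∀ A : Set X, MeasurableSet A → MeasurableSet (Φ A)) ∧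
  (Φ Set.univ = Set.univ ∧ Φ ∅ = ∅) ∧
  (∀ A B : Set X, MeasurableSet A → MeasurableSet B →
    (symmDiff A B).Countable → Φ A = Φ B) ∧
  (∀ A : Set X, MeasurableSet A → (symmDiff A (Φ A)).Countable) ∧
  (∀ A B : Set X, MeasurableSet A → MeasurableSet B → Φ (A ∩ B) = Φ A ∩ Φ B) ∧
  (∀ A B : Set X, MeasurableSet A → MeasurableSet B → Φ (A ∪ B) = Φ A ∪ Φ B)

/-- The continuum hypothesis does not depend on the universe in which it is stated. -/
theorem continuum_eq_aleph_one_iff.{u, v} :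
    continuum.{u} = ℵ₁ ↔ continuum.{v} = ℵ₁ := by
  rw [← lift_eq_aleph_one.{u, v}, ← lift_eq_aleph_one.{v, u}, lift_continuum, lift_continuum]

/-- Easy half of Sierpiński's theorem: if the square of a set is covered by a relation with
countable vertical sections and a relation with countable horizontal sections, then the set has
cardinality at most `ℵ₁`. -/
theorem mk_le_aleph_one_of_countable_sections {X : Type*} (V H : X → X → Prop)
    (hVH : ∀ a b, V a b ∨ H a b) (hV : ∀ a, {b | V a b}.Countable)
    (hH : ∀ b, {a | H a b}.Countable) : #X ≤ ℵ₁ := by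
  by_contra! hlt
  obtain ⟨S, hS⟩ := le_mk_iff_exists_set.1 hlt.le
  have hU : #(⋃ a ∈ S, {b | V a b} : Set X) ≤ ℵ₁ := by
    refine (mk_biUnion_le _ _).trans ?_
    rw [hS]
    refine (mul_le_mul_right (ciSup_le' fun a : S => (hV a).le_aleph0) _).trans ?_
    exact (Cardinal.mul_eq_left aleph0_lt_aleph_one.le aleph0_lt_aleph_one.le aleph0_ne_zero).le
  obtain ⟨b, hb⟩ : ∃ b, b ∉ ⋃ a ∈ S, {b | V a b} := by
    by_contra! h
    rw [eq_univ_of_forall h, mk_univ] at hU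
    exact hU.not_gt hlt
  have hSH : S ⊆ {a | H a b} := fun a ha =>
    (hVH a b).resolve_left fun h => hb (mem_biUnion ha h)
  have := ((hH b).mono hSH).le_aleph0
  rw [hS] at this
  exact this.not_gt aleph0_lt_aleph_one

/-- A lifting on a space Borel isomorphic to its square bounds its cardinality by `ℵ₁`. -/
theorem IsCountableLifting.mk_le_aleph_one {X : Type*} [MeasurableSpace X]
    [MeasurableSingletonClass X] {Φ : Set X → Set X} (hΦ : IsCountableLifting Φ)
    (e : X ≃ᵐ X × X) : #X ≤ ℵ₁ := by
  obtain ⟨-, ⟨-, hempty⟩, hcongr, hsim, hinter, -⟩ := hΦ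
  have hL (a : X) : MeasurableSet {x | (e x).1 = a} :=
    (measurable_fst.comp e.measurable) (measurableSet_singleton a)
  have hM (b : X) : MeasurableSet {x | (e x).2 = b} :=
    (measurable_snd.comp e.measurable) (measurableSet_singleton b)
  refine mk_le_aleph_one_of_countable_sections
    (fun a b => e.symm (a, b) ∉ Φ {x | (e x).1 = a})
    (fun a b => e.symm (a, b) ∉ Φ {x | (e x).2 = b}) (fun a b => ?_) (fun a => ?_) (fun b => ?_)
  · rw [← not_and_or, ← mem_inter_iff, ← hinter _ _ (hL a) (hM b),
      hcongr _ ∅ ((hL a).inter (hM b)) .empty, hempty]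
    · exact notMem_empty _
    · refine (countable_singleton (e.symm (a, b))).mono fun x hx => ?_
      obtain ⟨h1, h2⟩ : (e x).1 = a ∧ (e x).2 = b := by simpa [symmDiff] using hx
      rw [mem_singleton_iff, ← e.symm_apply_apply x, ← h1, ← h2]
  · refine ((hsim _ (hL a)).preimage_of_injOn (f := fun b => e.symm (a, b)) ?_).mono ?_
    · intro b _ c _ h
      simpa using h
    · intro b hb
      exact Or.inl ⟨by simp, hb⟩
  · refine ((hsim _ (hM b)).preimage_of_injOn (f := fun a => e.symm (a, b)) ?_).mono ?_
    · intro a _ c _ h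
      simpa using h
    · intro a ha
      exact Or.inl ⟨by simp, ha⟩

/-- Only countably many points lie in a countable atom of a given finite family of sets. -/
theorem countable_setOf_countable_atom {X : Type*} {F : Set (Set X)} (hF : F.Finite) :
    {x : X | {y | ∀ A ∈ F, (y ∈ A ↔ x ∈ A)}.Countable}.Countable := by
  let trace (x : X) : Set (Set X) := {A ∈ F | x ∈ A}
  have hatom (x : X) : {y | ∀ A ∈ F, (y ∈ A ↔ x ∈ A)} = trace ⁻¹' {trace x} := by
    ext y
    simp only [trace, mem_ofPred_eq, mem_preimage, mem_singleton_iff, Set.ext_iff]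
    exact forall_congr' fun A => by tauto
  simp only [hatom]
  have hfin : (trace '' {x | (trace ⁻¹' {trace x}).Countable}).Finite :=
    hF.finite_subsets.subset (by rintro _ ⟨x, -, rfl⟩ A hA; exact hA.1)
  refine (hfin.countable.biUnion (t := fun T _ => trace ⁻¹' {T}) ?_).mono fun x hx =>
    mem_biUnion (mem_image_of_mem trace hx) rfl
  rintro _ ⟨x, hx, rfl⟩
  exact hx

/-- A lifting given by a family of ultrafilters. -/
theorem isCountableLifting_of_ultrafilter {X : Type*} [MeasurableSpace X]
    [MeasurableSingletonClass X] (U : X → Ultrafilter X)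
    (hU : ∀ x, (U x : Filter X) ≤ Filter.cocountable)
    (hsim : ∀ A, MeasurableSet A → {x | ¬ (A ∈ U x ↔ x ∈ A)}.Countable) :
    IsCountableLifting fun A => {x | A ∈ U x} := by
  have hsymm (A : Set X) (hA : MeasurableSet A) : (symmDiff A {x | A ∈ U x}).Countable := by
    refine (hsim A hA).mono fun x hx => ?_
    simp only [mem_symmDiff, mem_ofPred_eq] at hx ⊢
    tauto
  refine ⟨fun A hA => ?_, ⟨?_, ?_⟩, fun A B _ _ hAB => ?_, hsymm, fun A B _ _ => ?_,
    fun A B _ _ => ?_⟩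
  · change MeasurableSet {x | A ∈ U x}
    rw [← symmDiff_symmDiff_cancel_left A {x | A ∈ U x}]
    exact hA.symmDiff (hsymm A hA).measurableSet
  · exact eq_univ_of_forall fun x => Filter.univ_mem
  · exact eq_empty_of_forall_notMem fun x => (U x).empty_notMem
  · ext x
    have hx : (symmDiff A B)ᶜ ∈ U x := hU x (by simpa using hAB)
    refine ⟨fun h => ?_, fun h => ?_⟩ <;>
    · refine Filter.mem_of_superset (Filter.inter_mem h hx) fun y hy => ?_
      simp only [mem_inter_iff, mem_compl_iff, mem_symmDiff] at hy
      tauto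
  · ext x
    exact Filter.inter_mem_iff
  · ext x
    exact Ultrafilter.union_mem_iff

/-- An uncountable space with at most `ℵ₁` measurable sets has a lifting. -/
theorem exists_isCountableLifting.{u} {X : Type u} [MeasurableSpace X] [MeasurableSingletonClass X]
    [Uncountable X] (h : #{A : Set X // MeasurableSet A} ≤ ℵ₁) :
    ∃ Φ : Set X → Set X, IsCountableLifting Φ := by
  let W : Type u := (ℵ₁ : Cardinal.{u}).ord.ToType
  obtain ⟨⟨s, hs⟩⟩ : Nonempty ({A : Set X // MeasurableSet A} ↪ W) := by
    rwa [← le_def, mk_ord_toType]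
  have hW (w : W) : (Iic w).Countable := by
    rw [← Iio_insert, countable_insert, ← le_aleph0_iff_set_countable, ← lt_aleph_one_iff]
    simpa only [W, mk_ord_toType] using mk_Iio_lt w (by simp [W])
  let family (w : W) : Set (Set X) := {A | ∃ hA : MeasurableSet A, s ⟨A, hA⟩ ≤ w}
  have hfamily (w : W) : (family w).Countable := by
    refine (((hW w).preimage hs).image Subtype.val).mono ?_
    rintro A ⟨hA, hle⟩
    exact ⟨⟨A, hA⟩, hle, rfl⟩
  let atom (F : Set (Set X)) (x : X) : Set X := {y | ∀ A ∈ F, (y ∈ A ↔ x ∈ A)}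
  let bad (w : W) : Set X := {x | ∃ F ⊆ family w, F.Finite ∧ (atom F x).Countable}
  have hbad (w : W) : (bad w).Countable := by
    have hc := countable_ofPred_finite_subset (hfamily w)
    refine (hc.biUnion (t := fun F _ => {x | (atom F x).Countable})
      fun F hF => countable_setOf_countable_atom hF.1).mono ?_
    rintro x ⟨F, hF, hfin, hx⟩
    exact mem_biUnion (show F ∈ {t | t.Finite ∧ t ⊆ family w} from ⟨hfin, hF⟩) hx
  let good (x : X) : Set (Set X) := {A | ∃ hA : MeasurableSet A, x ∉ bad (s ⟨A, hA⟩)}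
  have hgood (x : X) (F : Set (Set X)) (hF : F ⊆ good x) (hfin : F.Finite) :
      ¬ (atom F x).Countable := by
    intro hc
    rcases F.eq_empty_or_nonempty with rfl | hne
    · exact not_countable_univ (α := X) (by simpa [atom] using hc)
    · have hmeas (A) (hA : A ∈ F) : MeasurableSet A := (hF hA).1
      classical
      let s' (A : Set X) : W := if hA : MeasurableSet A then s ⟨A, hA⟩ else s ⟨∅, .empty⟩
      obtain ⟨A, hA, hmax⟩ := exists_max_image F s' hfin hne
      obtain ⟨hAm, hAx⟩ := hF hA
      refine hAx ⟨F, fun B hB => ⟨hmeas B hB, ?_⟩, hfin, hc⟩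
      simpa [s', hAm, hmeas B hB] using hmax B hB
  have hne (x : X) : ((⨅ A : good x, Filter.principal {y | y ∈ A.1 ↔ x ∈ A.1}) ⊓
      Filter.cocountable).NeBot := by
    rw [(Filter.hasBasis_iInf_principal_finite _).inf_neBot_iff]
    intro t ht C hC
    rw [Filter.mem_cocountable] at hC
    by_contra hempty
    refine hgood x (Subtype.val '' t) (by simp) (ht.image _) (hC.mono ?_)
    refine fun y hy hyC => hempty ⟨y, ?_, hyC⟩
    simp only [mem_iInter]
    exact fun A hA => hy A.1 ⟨A, hA, rfl⟩
  refine ⟨_, isCountableLifting_of_ultrafilter (fun x => @Ultrafilter.of X _ (hne x))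
    (fun x => ?_) fun A hA => ?_⟩
  · have := hne x
    exact (Ultrafilter.of_le _).trans inf_le_right
  · refine (hbad (s ⟨A, hA⟩)).mono fun x hx => ?_
    by_contra hxb
    have := hne x
    have hmem : {y | y ∈ A ↔ x ∈ A} ∈ Ultrafilter.of
        ((⨅ A : good x, Filter.principal {y | y ∈ A.1 ↔ x ∈ A.1}) ⊓ Filter.cocountable) :=
      Ultrafilter.of_le _ (Filter.mem_inf_of_left
        (Filter.mem_iInf_of_mem (⟨A, hA, hxb⟩ : good x) (Filter.mem_principal_self _)))
    refine hx ⟨fun hAU => ?_, fun hxA => ?_⟩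
    · obtain ⟨y, hyA, hy⟩ := Filter.nonempty_of_mem (Filter.inter_mem hAU hmem)
      exact hy.1 hyA
    · exact Filter.mem_of_superset hmem fun y hy => hy.2 hxA

theorem ch_iff_exists_borel_lifting (X : Type) [TopologicalSpace X] [PolishSpace X]
    [MeasurableSpace X] [BorelSpace X] [Uncountable X] :
    Cardinal.continuum = Cardinal.aleph 1 ↔
      ∃ Φ : Set X → Set X, IsCountableLifting Φ := by
  constructor
  · intro hCH
    refine exists_isCountableLifting ?_
    obtain ⟨b, hb, hgen⟩ := (inferInstance : MeasurableSpace.CountablyGenerated X)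
    subst hgen
    rw [← continuum_eq_aleph_one_iff.1 hCH]
    exact MeasurableSpace.cardinal_measurableSet_le_continuum
      (hb.le_aleph0.trans aleph0_le_continuum)
  · rintro ⟨Φ, hΦ⟩
    have hX : ¬ Countable X := not_countable
    have hXX : ¬ Countable (X × X) := not_countable
    have hle := hΦ.mk_le_aleph_one (PolishSpace.measurableEquivOfNotCountable hX hXX)
    have hcard : #X = 𝔠 := by
      rw [← mk_real]
      exact mk_congr (PolishSpace.measurableEquivOfNotCountable hX
        (not_countable (α := ℝ))).toEquiv
    exact continuum_eq_aleph_one_iff.2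
      (le_antisymm (hcard.symm.trans_le hle) aleph_one_le_continuum)
end

section
/- If there exists a lower density operator Φ : 𝓑 → 𝓑 on the σ-algebra 𝓑 of Borel subsets of ℝ × ℝ with respect to the σ-ideal of countable subsets of ℝ × ℝ, then the Continuum Hypothesis holds. -/
open Set Cardinal

/-- `Φ` is a lower density operator on the Borel σ-algebra of `X` with respect to the
σ-ideal of countable sets: it maps Borel sets to Borel sets and satisfies (1)–(4). -/
def IsCountableLowerDensity {X : Type*} [MeasurableSpace X] (Φ : Set X → Set X) : Prop :=
  (∀ A : Set X, MeasurableSet A → MeasurableSet (Φ A)) ∧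
  (Φ Set.univ = Set.univ ∧ Φ ∅ = ∅) ∧
  (∀ A B : Set X, MeasurableSet A → MeasurableSet B →
    (symmDiff A B).Countable → Φ A = Φ B) ∧
  (∀ A : Set X, MeasurableSet A → (symmDiff A (Φ A)).Countable) ∧
  (∀ A B : Set X, MeasurableSet A → MeasurableSet B → Φ (A ∩ B) = Φ A ∩ Φ B)

namespace IsCountableLowerDensity

variable {X : Type*} [MeasurableSpace X] {Φ : Set X → Set X}

theorem countable_diff (hΦ : IsCountableLowerDensity Φ) {A : Set X} (hA : MeasurableSet A) :
    (A \ Φ A).Countable :=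
  (hΦ.2.2.2.1 A hA).mono fun _ hx => Or.inl hx

theorem disjoint_of_countable_inter (hΦ : IsCountableLowerDensity Φ) {A B : Set X}
    (hA : MeasurableSet A) (hB : MeasurableSet B) (hAB : (A ∩ B).Countable) :
    Disjoint (Φ A) (Φ B) := by
  obtain ⟨-, ⟨-, hempty⟩, hcongr, -, hinter⟩ := hΦ
  rw [disjoint_iff_inter_eq_empty, ← hinter A B hA hB, ← hempty]
  exact hcongr _ _ (hA.inter hB) MeasurableSet.empty (by simpa [symmDiff_def] using hAB)

end IsCountableLowerDensity

/-- **Sierpiński's theorem**: if every horizontal section of a set `A ⊆ α × α` and every vertical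
section of its complement is countable, then `α` has cardinality at most `ℵ₁`. -/
theorem mk_le_aleph_one_of_countable_sections_s2 {α : Type*} (A : Set (α × α))
    (hvert : ∀ x, {y | (x, y) ∉ A}.Countable) (hhor : ∀ y, {x | (x, y) ∈ A}.Countable) :
    #α ≤ ℵ₁ := by
  by_contra! h
  obtain ⟨S, hS⟩ := le_mk_iff_exists_set.1 h.le
  have hunion : #(⋃ x : S, {y | (x.1, y) ∉ A}) ≤ ℵ₁ := by
    refine (mk_iUnion_le _).trans ?_
    rw [hS]
    refine (mul_le_mul_right (ciSup_le' fun x : S => (hvert x).le_aleph0) _).trans ?_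
    exact (mul_aleph0_eq (aleph0_le_aleph 1)).le
  obtain ⟨y, hy⟩ : ∃ y, y ∉ ⋃ x : S, {y | (x.1, y) ∉ A} := by
    by_contra! hall
    rw [eq_univ_of_forall hall, mk_univ] at hunion
    exact hunion.not_gt h
  simp only [mem_iUnion, mem_ofPred_eq, not_exists, not_not] at hy
  have hcount : S.Countable := (hhor y).mono fun x hx => hy ⟨x, hx⟩
  exact aleph0_lt_aleph_one.not_ge (hS ▸ hcount.le_aleph0)

theorem ch_of_exists_borel_lower_density_on_plane
    (Φ : Set (ℝ × ℝ) → Set (ℝ × ℝ)) (hΦ : IsCountableLowerDensity Φ) :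
    Cardinal.continuum = Cardinal.aleph 1 := by
  suffices h : #ℝ ≤ ℵ₁ by
    rw [mk_real] at h
    have h0 : Cardinal.continuum.{0} = Cardinal.aleph 1 := h.antisymm aleph_one_le_continuum
    simpa using congrArg Cardinal.lift h0
  have hV (x : ℝ) : MeasurableSet ({x} ×ˢ Set.univ : Set (ℝ × ℝ)) :=
    (measurableSet_singleton x).prod MeasurableSet.univ
  have hH (y : ℝ) : MeasurableSet (Set.univ ×ˢ {y} : Set (ℝ × ℝ)) :=
    MeasurableSet.univ.prod (measurableSet_singleton y)
  refine mk_le_aleph_one_of_countable_sections_s2 {p : ℝ × ℝ | p ∈ Φ ({p.1} ×ˢ Set.univ)}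
    (fun x => ?_) (fun y => ?_)
  · refine ((hΦ.countable_diff (hV x)).preimage (Prod.mk_right_injective x)).mono ?_
    intro y hy
    exact ⟨by simp, hy⟩
  · refine ((hΦ.countable_diff (hH y)).preimage (Prod.mk_left_injective y)).mono ?_
    intro x hx
    refine ⟨by simp, (hΦ.disjoint_of_countable_inter (hV x) (hH y) ?_).notMem_of_mem_left hx⟩
    simp [prod_inter_prod]
end

section
/- Assume the Continuum Hypothesis. Then for every uncountable Polish space X there exists a lifting Φ : 𝓑 → 𝓑 on the σ-algebra 𝓑 of Borel subsets of X with respect to the σ-ideal of countable subsets of X. -/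
open Set Cardinal

/-- The points which `A b`, `b ∈ F`, do not separate from `x`. -/
def finsetCell {ι X : Type*} (A : ι → Set X) (F : Finset ι) (x : X) : Set X :=
  {y | ∀ b ∈ F, y ∈ A b ↔ x ∈ A b}

lemma finsetCell_anti {ι X : Type*} (A : ι → Set X) {F G : Finset ι} (h : F ⊆ G) (x : X) :
    finsetCell A G x ⊆ finsetCell A F x :=
  fun _ hy b hb => hy b (h hb)

/-- The points lying in a countable cell cut out by finitely many of the sets `A b`, `b ≤ a`. -/
def countableCells {ι X : Type*} [LE ι] (A : ι → Set X) (a : ι) : Set X :=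
  {x | ∃ F : Finset ι, (∀ b ∈ F, b ≤ a) ∧ (finsetCell A F x).Countable}

lemma countable_countableCells {ι X : Type*} [LE ι] (A : ι → Set X) (a : ι)
    (ha : {b | b ≤ a}.Countable) : (countableCells A a).Countable := by
  classical
  have hfin : {F : Finset ι | ∀ b ∈ F, b ≤ a}.Countable := by
    refine ((Set.countable_ofPred_finite_subset ha).preimage_of_injOn
      (f := fun F : Finset ι => (F : Set ι)) Finset.coe_injective.injOn).mono ?_
    intro F hF
    exact ⟨F.finite_toSet, hF⟩
  have hcov : (⋃ p ∈ {F : Finset ι | ∀ b ∈ F, b ≤ a} ×ˢ {F : Finset ι | ∀ b ∈ F, b ≤ a},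
      {x : X | p.2 = {b ∈ p.1 | x ∈ A b} ∧ (finsetCell A p.1 x).Countable}).Countable := by
    refine (hfin.prod hfin).biUnion fun p _ => ?_
    rcases Set.eq_empty_or_nonempty
      {x : X | p.2 = {b ∈ p.1 | x ∈ A b} ∧ (finsetCell A p.1 x).Countable} with h | ⟨x, hx, hc⟩
    · rw [h]; exact Set.countable_empty
    · refine hc.mono ?_
      intro y hy b hb
      have := Finset.ext_iff.1 (hy.1.symm.trans hx) b
      simpa [hb] using this
  refine hcov.mono ?_
  rintro x ⟨F, hF, hc⟩
  exact Set.mem_biUnion (x := (F, {b ∈ F | x ∈ A b}))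
    ⟨hF, fun b hb => hF b (Finset.mem_filter.1 hb).1⟩ ⟨rfl, hc⟩

/-- If a family of sets is indexed by a linear order with countable initial segments, then the
principal ultrafilters can be replaced by ultrafilters containing all cocountable sets, so that
the membership of each set of the family changes at only countably many points. -/
lemma exists_ultrafilter_le_cocountable {ι X : Type*} [LinearOrder ι] [Uncountable X]
    (A : ι → Set X) (hι : ∀ a : ι, {b | b ≤ a}.Countable) :
    ∃ U : X → Ultrafilter X, (∀ x, (U x : Filter X) ≤ Filter.cocountable) ∧
      ∀ a, {x | ¬ (A a ∈ U x ↔ x ∈ A a)}.Countable := by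
  classical
  have key : ∀ x : X, ∃ U : Ultrafilter X, (U : Filter X) ≤ Filter.cocountable ∧
      ∀ a, x ∉ countableCells A a → (A a ∈ U ↔ x ∈ A a) := by
    intro x
    let I := {F : Finset ι // ∀ a ∈ F, x ∉ countableCells A a}
    let f : I → Filter X := fun F => Filter.cocountable ⊓ Filter.principal (finsetCell A F.1 x)
    have : Nonempty I := ⟨⟨∅, by simp⟩⟩
    have hdir : Directed (· ≥ ·) f := by
      intro F G
      refine ⟨⟨F.1 ∪ G.1, fun a ha => (Finset.mem_union.1 ha).elim (F.2 a) (G.2 a)⟩, ?_, ?_⟩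
      · exact inf_le_inf_left _ (Filter.principal_mono.2
          (finsetCell_anti A Finset.subset_union_left x))
      · exact inf_le_inf_left _ (Filter.principal_mono.2
          (finsetCell_anti A Finset.subset_union_right x))
    have hcell : ∀ F : I, ¬ (finsetCell A F.1 x).Countable := by
      rintro ⟨F, hF⟩ hc
      rcases F.eq_empty_or_nonempty with rfl | hne
      · exact Set.not_countable_univ (hc.mono fun y _ b hb => by simp at hb)
      · exact hF _ (F.max'_mem hne) ⟨F, fun b hb => F.le_max' b hb, hc⟩
    have hbot : ∀ F, (f F).NeBot := by
      intro F
      refine Filter.inf_principal_neBot_iff.2 fun V hV => ?_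
      by_contra hemp
      exact hcell F ((Filter.mem_cocountable.1 hV).mono fun y hy hyV => hemp ⟨y, hyV, hy⟩)
    have : (iInf f).NeBot := Filter.iInf_neBot_of_directed' hdir hbot
    obtain ⟨U, hU⟩ := Ultrafilter.exists_le (iInf f)
    refine ⟨U, hU.trans ((iInf_le f ⟨∅, by simp⟩).trans inf_le_left), fun a ha => ?_⟩
    have hmem : finsetCell A {a} x ∈ U :=
      Filter.le_principal_iff.1 (hU.trans ((iInf_le f ⟨{a}, by simpa using ha⟩).trans inf_le_right))
    have hiff : ∀ y ∈ finsetCell A {a} x, y ∈ A a ↔ x ∈ A a :=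
      fun y hy => hy a (Finset.mem_singleton_self a)
    constructor
    · intro h
      obtain ⟨y, hy, hyA⟩ := U.nonempty_of_mem (Filter.inter_mem hmem h)
      exact (hiff y hy).1 hyA
    · exact fun h => Filter.mem_of_superset hmem fun y hy => (hiff y hy).2 h
  choose U hU hUA using key
  exact ⟨U, hU, fun a => (countable_countableCells A a (hι a)).mono fun x hx =>
    by_contra fun h => hx (hUA x a h)⟩

lemma exists_linearOrder_countable_Iic {ι : Type*} (h : #ι ≤ ℵ_ 1) :
    ∃ _ : LinearOrder ι, ∀ a : ι, {b | b ≤ a}.Countable := by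
  obtain ⟨o, wo, ho⟩ := Cardinal.exists_ord_eq_type_lt ι
  refine ⟨o, fun a => ?_⟩
  have hlt : (Set.Iio a).Countable :=
    Cardinal.le_aleph0_iff_set_countable.1 (Cardinal.lt_aleph_one_iff.1 <| (Cardinal.mk_Iio_lt a ho).trans_le h)
  refine (hlt.insert a).mono fun b (hb : b ≤ a) => ?_
  exact hb.eq_or_lt

theorem exists_borel_lifting_of_ch (hCH : Cardinal.continuum = Cardinal.aleph 1)
    (X : Type) [TopologicalSpace X] [PolishSpace X]
    [MeasurableSpace X] [BorelSpace X] [Uncountable X] :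
    ∃ Φ : Set X → Set X, IsCountableLifting Φ := by
  have hCH₀ : (𝔠 : Cardinal.{0}) = ℵ_ 1 := Cardinal.lift_injective (by simpa using hCH)
  have hcard : #{A : Set X // MeasurableSet A} ≤ ℵ_ 1 := by
    obtain ⟨b, hb, hgen⟩ := MeasurableSpace.CountablyGenerated.isCountablyGenerated (α := X)
    subst hgen
    rw [← hCH₀]
    exact MeasurableSpace.cardinal_measurableSet_le_continuum
      (hb.le_aleph0.trans Cardinal.aleph0_le_continuum)
  obtain ⟨_, hι⟩ := exists_linearOrder_countable_Iic hcard
  obtain ⟨U, hU, hUA⟩ := exists_ultrafilter_le_cocountable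
    (fun A : {A : Set X // MeasurableSet A} => A.1) hι
  have hdiff : ∀ A : Set X, MeasurableSet A → (symmDiff A {x | A ∈ U x}).Countable := by
    refine fun A hA => (hUA ⟨A, hA⟩).mono fun x hx => ?_
    rw [Set.mem_symmDiff] at hx
    simp only [Set.mem_ofPred_eq] at hx ⊢
    tauto
  refine ⟨fun A => {x | A ∈ U x}, fun A hA => ?_, ⟨?_, ?_⟩, ?_, hdiff, ?_, ?_⟩
  · have := hA.symmDiff (hdiff A hA).measurableSet
    rwa [symmDiff_symmDiff_cancel_left] at this
  · ext x; exact iff_of_true Filter.univ_mem trivial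
  · ext x; simp
  · intro A B _ _ h
    ext x
    have hmem : (symmDiff A B)ᶜ ∈ U x :=
      hU x (Filter.mem_cocountable.2 (by rwa [compl_compl]))
    have hiff : ∀ y ∈ (symmDiff A B)ᶜ, y ∈ A ↔ y ∈ B := by
      intro y hy
      rw [Set.mem_compl_iff, Set.mem_symmDiff] at hy
      tauto
    exact Filter.congr_sets (Filter.mem_of_superset hmem hiff)
  · intro A B _ _
    ext x
    exact Filter.inter_mem_iff
  · intro A B _ _
    ext x
    exact Ultrafilter.union_mem_iff
end
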